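/- Let −∞ ≤ a < 0 < b ≤ ∞ and let w : (a,b) → (0,∞) be an integrable function such that x ↦ log w(x) is concave on (a,b), ∫_a^b w(x) dx = 1, and ∫_a^b x·w(x) dx = 0. If equality ∫_a^0 w(x) dx = e^{-1} holds, then there exists c > 0 such that a = −∞, b = 1/c, and w(x) = c·e^{c·x − 1} for all x ∈ (a,b). -/

import Mathlib

open MeasureTheory

/-- The set of real numbers lying strictly between two extended real numbers. -/
def erealIoo (a b : EReal) : Set ℝ := {x : ℝ | a < (x : EReal) ∧ (x : EReal) < b}

/-- `w` is a positive log-concave probability density on the open convex set `I` of reals. -/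
structure IsLogConcaveDensity (I : Set ℝ) (w : ℝ → ℝ) : Prop where
  isOpen : IsOpen I
  convex : Convex ℝ I
  pos : ∀ x ∈ I, 0 < w x
  integrableOn : IntegrableOn w I
  concaveOn_log : ConcaveOn ℝ I (fun x => Real.log (w x))
  integral_eq_one : ∫ x in I, w x = 1

/-- The distribution function of the density `w` on `I`. -/
noncomputable def distribFun (I : Set ℝ) (w : ℝ → ℝ) (x : ℝ) : ℝ :=
  ∫ t in Set.Iic x, I.indicator w t

/-- A concave function has a larger sum at two inner points than at two outer points with the
same midpoint. -/
theorem ConcaveOn.add_le_add_of_mem_Icc {I : Set ℝ} {f : ℝ → ℝ} (hf : ConcaveOn ℝ I f)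
    {t x y : ℝ} (ht : t ∈ I) (hy : y ∈ I) (htx : t ≤ x) (hxy : x ≤ y) :
    f t + f y ≤ f x + f (t + (y - x)) := by
  rcases (htx.trans hxy).eq_or_lt with rfl | hty
  · obtain rfl := le_antisymm htx hxy
    simp
  have hd : 0 < y - t := sub_pos.2 hty
  have h0 : 0 ≤ (x - t) / (y - t) := div_nonneg (sub_nonneg.2 htx) hd.le
  have h1 : 0 ≤ (y - x) / (y - t) := div_nonneg (sub_nonneg.2 hxy) hd.le
  have hs : (y - x) / (y - t) + (x - t) / (y - t) = 1 := by field_simp; ring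
  have hs' : (x - t) / (y - t) + (y - x) / (y - t) = 1 := by rw [add_comm, hs]
  have e1 : (y - x) / (y - t) * t + (x - t) / (y - t) * y = x := by field_simp; ring
  have e2 : (x - t) / (y - t) * t + (y - x) / (y - t) * y = t + (y - x) := by field_simp; ring
  have k1 := hf.2 ht hy h1 h0 hs
  have k2 := hf.2 ht hy h0 h1 hs'
  simp only [smul_eq_mul, e1, e2] at k1 k2
  calc f t + f y = ((y - x) / (y - t) + (x - t) / (y - t)) * (f t + f y) := by rw [hs, one_mul]
    _ ≤ f x + f (t + (y - x)) := by linarith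

namespace IsLogConcaveDensity

variable {I : Set ℝ} {w : ℝ → ℝ}

theorem continuousOn (h : IsLogConcaveDensity I w) : ContinuousOn w I :=
  (Real.continuous_exp.comp_continuousOn (h.concaveOn_log.continuousOn h.isOpen)).congr
    fun x hx => (Real.exp_log (h.pos x hx)).symm

theorem measurableSet (h : IsLogConcaveDensity I w) : MeasurableSet I := h.isOpen.measurableSet

theorem integrable_indicator (h : IsLogConcaveDensity I w) : Integrable (I.indicator w) :=
  (integrable_indicator_iff h.measurableSet).2 h.integrableOn

theorem indicator_nonneg (h : IsLogConcaveDensity I w) (x : ℝ) : 0 ≤ I.indicator w x :=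
  Set.indicator_nonneg (fun x hx => (h.pos x hx).le) x

theorem comp_neg (h : IsLogConcaveDensity I w) : IsLogConcaveDensity (-I) fun x => w (-x) where
  isOpen := h.isOpen.neg
  convex := h.convex.neg
  pos x hx := h.pos (-x) hx
  integrableOn := h.integrableOn.comp_neg
  concaveOn_log := by
    refine ⟨h.convex.neg, fun x hx y hy a b ha hb hab => ?_⟩
    have := h.concaveOn_log.2 hx hy ha hb hab
    simpa [add_comm] using this
  integral_eq_one := by
    rw [← h.integral_eq_one, ← integral_indicator h.measurableSet,
      ← integral_indicator h.measurableSet.neg, ← integral_neg_eq_self (I.indicator w)]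
    rfl

theorem distribFun_eq_add (h : IsLogConcaveDensity I w) (x y : ℝ) :
    distribFun I w y = distribFun I w x + ∫ t in x..y, I.indicator w t := by
  rw [distribFun, distribFun, ← intervalIntegral.integral_Iic_sub_Iic
    h.integrable_indicator.integrableOn h.integrable_indicator.integrableOn]
  ring

theorem continuous_distribFun (h : IsLogConcaveDensity I w) : Continuous (distribFun I w) := by
  rw [funext (h.distribFun_eq_add 0)]
  exact continuous_const.add (intervalIntegral.continuous_primitive
    (fun _ _ => h.integrable_indicator.intervalIntegrable) 0)

theorem hasDerivAt_distribFun (h : IsLogConcaveDensity I w) {x : ℝ} (hx : x ∈ I) :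
    HasDerivAt (distribFun I w) (w x) x := by
  have he : I.indicator w =ᶠ[nhds x] w := by
    filter_upwards [h.isOpen.mem_nhds hx] with y hy using Set.indicator_of_mem hy w
  have hd := intervalIntegral.integral_hasDerivAt_right
    (h.integrable_indicator.intervalIntegrable (a := 0) (b := x))
    h.integrable_indicator.aestronglyMeasurable.stronglyMeasurableAtFilter
    ((h.continuousOn.continuousAt (h.isOpen.mem_nhds hx)).congr he.symm)
  rw [Set.indicator_of_mem hx] at hd
  rw [funext (h.distribFun_eq_add 0)]
  exact hd.const_add _

theorem strictMonoOn_distribFun (h : IsLogConcaveDensity I w) :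
    StrictMonoOn (distribFun I w) I :=
  strictMonoOn_of_deriv_pos h.convex h.continuous_distribFun.continuousOn fun x hx => by
    rw [(h.hasDerivAt_distribFun (interior_subset hx)).deriv]
    exact h.pos x (interior_subset hx)

theorem distribFun_nonneg (h : IsLogConcaveDensity I w) (x : ℝ) : 0 ≤ distribFun I w x :=
  setIntegral_nonneg measurableSet_Iic fun t _ => h.indicator_nonneg t

theorem distribFun_le_one (h : IsLogConcaveDensity I w) (x : ℝ) : distribFun I w x ≤ 1 := by
  rw [← h.integral_eq_one, ← integral_indicator h.measurableSet]
  exact setIntegral_le_integral h.integrable_indicator (Filter.Eventually.of_forall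
    h.indicator_nonneg)

theorem distribFun_pos (h : IsLogConcaveDensity I w) {x : ℝ} (hx : x ∈ I) :
    0 < distribFun I w x := by
  obtain ⟨y, hyx, hy⟩ := Filter.nonempty_of_mem (Filter.inter_mem self_mem_nhdsWithin
    (mem_nhdsWithin_of_mem_nhds (h.isOpen.mem_nhds hx) : I ∈ nhdsWithin x (Set.Iio x)))
  exact (h.distribFun_nonneg y).trans_lt (h.strictMonoOn_distribFun hy hx hyx)

theorem distribFun_lt_one (h : IsLogConcaveDensity I w) {x : ℝ} (hx : x ∈ I) :
    distribFun I w x < 1 := by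
  obtain ⟨y, hxy, hy⟩ := Filter.nonempty_of_mem (Filter.inter_mem self_mem_nhdsWithin
    (mem_nhdsWithin_of_mem_nhds (h.isOpen.mem_nhds hx) : I ∈ nhdsWithin x (Set.Ioi x)))
  exact (h.strictMonoOn_distribFun hx hy hxy).trans_le (h.distribFun_le_one y)

theorem tendsto_distribFun_atBot (h : IsLogConcaveDensity I w) :
    Filter.Tendsto (distribFun I w) Filter.atBot (nhds 0) := by
  have ht := (intervalIntegral_tendsto_integral_Iic (0 : ℝ)
    h.integrable_indicator.integrableOn Filter.tendsto_id).const_sub (distribFun I w 0)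
  rw [← distribFun, sub_self] at ht
  refine ht.congr fun x => ?_
  rw [h.distribFun_eq_add x 0, id, add_sub_cancel_right]

theorem tendsto_distribFun_atTop (h : IsLogConcaveDensity I w) :
    Filter.Tendsto (distribFun I w) Filter.atTop (nhds 1) := by
  have ht := (intervalIntegral_tendsto_integral_Ioi (0 : ℝ)
    h.integrable_indicator.integrableOn Filter.tendsto_id).const_add (distribFun I w 0)
  have h1 : distribFun I w 0 + ∫ t in Set.Ioi (0 : ℝ), I.indicator w t = 1 := by
    rw [distribFun, intervalIntegral.integral_Iic_add_Ioi h.integrable_indicator.integrableOn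
      h.integrable_indicator.integrableOn, integral_indicator h.measurableSet,
      h.integral_eq_one]
  rw [h1] at ht
  exact ht.congr fun x => (h.distribFun_eq_add 0 x).symm

/-- Outside `I`, the distribution function only takes the values `0` and `1`. -/
theorem distribFun_eq_zero_or_one (h : IsLogConcaveDensity I w) {x : ℝ} (hx : x ∉ I) :
    distribFun I w x = 0 ∨ distribFun I w x = 1 := by
  by_cases hl : ∃ y ∈ I, y ≤ x
  · obtain ⟨y, hy, hyx⟩ := hl
    right
    rw [distribFun, ← h.integral_eq_one, ← integral_indicator h.measurableSet]
    refine setIntegral_eq_integral_of_forall_compl_eq_zero fun t ht => ?_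
    refine Set.indicator_of_notMem (fun htI => hx ?_) w
    exact h.convex.ordConnected.out hy htI ⟨hyx, (not_le.1 ht).le⟩
  · push Not at hl
    left
    refine setIntegral_eq_zero_of_forall_eq_zero fun t ht => ?_
    exact Set.indicator_of_notMem (fun htI => (hl t htI).not_ge ht) w

theorem image_distribFun (h : IsLogConcaveDensity I w) :
    distribFun I w '' I = Set.Ioo 0 1 := by
  apply Set.Subset.antisymm
  · rintro _ ⟨x, hx, rfl⟩
    exact ⟨h.distribFun_pos hx, h.distribFun_lt_one hx⟩
  · intro u hu
    obtain ⟨x, rfl⟩ := mem_range_of_exists_le_of_exists_ge h.continuous_distribFun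
      ((h.tendsto_distribFun_atBot.eventually_le_const hu.1).exists)
      ((h.tendsto_distribFun_atTop.eventually_const_le hu.2).exists)
    refine ⟨x, by_contra fun hx => ?_, rfl⟩
    rcases h.distribFun_eq_zero_or_one hx with h0 | h1
    · exact hu.1.ne' h0
    · exact hu.2.ne h1

theorem integrableOn_log_distribFun_mul (h : IsLogConcaveDensity I w) :
    IntegrableOn (fun x => Real.log (distribFun I w x) * w x) I := by
  have hl : IntegrableOn Real.log (Set.Ioo 0 1) :=
    (intervalIntegrable_iff_integrableOn_Ioo_of_le zero_le_one).1
      intervalIntegral.intervalIntegrable_log'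
  rw [← h.image_distribFun, integrableOn_image_iff_integrableOn_abs_deriv_smul h.measurableSet
    (fun x hx => (h.hasDerivAt_distribFun hx).hasDerivWithinAt)
    h.strictMonoOn_distribFun.injOn] at hl
  refine hl.congr_fun (fun x hx => ?_) h.measurableSet
  simp only [smul_eq_mul, abs_of_pos (h.pos x hx), mul_comm]

theorem integral_log_distribFun_mul (h : IsLogConcaveDensity I w) :
    ∫ x in I, Real.log (distribFun I w x) * w x = -1 := by
  have hl : ∫ u in Set.Ioo (0 : ℝ) 1, Real.log u = -1 := by
    rw [← integral_Ioc_eq_integral_Ioo, ← intervalIntegral.integral_of_le zero_le_one,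
      integral_log]
    simp
  rw [← hl, ← h.image_distribFun, integral_image_eq_integral_abs_deriv_smul h.measurableSet
    (fun x hx => (h.hasDerivAt_distribFun hx).hasDerivWithinAt)
    h.strictMonoOn_distribFun.injOn]
  refine setIntegral_congr_fun h.measurableSet fun x hx => ?_
  simp only [smul_eq_mul, abs_of_pos (h.pos x hx), mul_comm]

/-- The ratio `w / distribFun I w` is nonincreasing, in cross-multiplied form. -/
theorem distribFun_mul_le (h : IsLogConcaveDensity I w) {x y : ℝ} (hx : x ∈ I) (hy : y ∈ I)
    (hxy : x ≤ y) : distribFun I w x * w y ≤ distribFun I w y * w x := by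
  have hshift : distribFun I w y = ∫ t in Set.Iic x, I.indicator w (t + (y - x)) := by
    have := (measurePreserving_add_right volume (y - x)).setIntegral_preimage_emb
      (measurableEmbedding_addRight (y - x)) (I.indicator w) (Set.Iic y)
    rw [distribFun, ← this, Set.preimage_add_const_Iic, sub_sub_cancel]
  rw [hshift, distribFun, ← integral_mul_const, ← integral_mul_const]
  refine setIntegral_mono_on (h.integrable_indicator.mul_const _).integrableOn
    ((h.integrable_indicator.comp_add_right _).mul_const _).integrableOn measurableSet_Iic
    fun t ht => ?_
  by_cases htI : t ∈ I
  · have hsI : t + (y - x) ∈ I :=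
      h.convex.ordConnected.out htI hy ⟨by linarith, by linarith [Set.mem_Iic.1 ht]⟩
    rw [Set.indicator_of_mem htI, Set.indicator_of_mem hsI]
    have hl := h.concaveOn_log.add_le_add_of_mem_Icc htI hy ht hxy
    rw [← Real.log_mul (h.pos t htI).ne' (h.pos y hy).ne',
      ← Real.log_mul (h.pos x hx).ne' (h.pos _ hsI).ne', mul_comm (w x)] at hl
    exact (Real.log_le_log_iff (mul_pos (h.pos t htI) (h.pos y hy))
      (mul_pos (h.pos _ hsI) (h.pos x hx))).1 hl
  · rw [Set.indicator_of_notMem htI, zero_mul]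
    exact mul_nonneg (h.indicator_nonneg _) (h.pos x hx).le

/-- The logarithm of the distribution function lies below its tangent line at `0`. -/
theorem log_distribFun_le (h : IsLogConcaveDensity I w) (h0 : (0 : ℝ) ∈ I) {x : ℝ}
    (hx : x ∈ I) : Real.log (distribFun I w x) ≤
      Real.log (distribFun I w 0) + w 0 / distribFun I w 0 * x := by
  set c := w 0 / distribFun I w 0 with hc
  have hd : ∀ y ∈ I, HasDerivAt (fun z => Real.log (distribFun I w z) - c * z)
      (w y / distribFun I w y - c) y := fun y hy => by
    simpa using ((h.hasDerivAt_distribFun hy).log (h.distribFun_pos hy).ne').fun_sub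
      ((hasDerivAt_id y).const_mul c)
  have hcont : ContinuousOn (fun z => Real.log (distribFun I w z) - c * z) I :=
    fun y hy => (hd y hy).continuousAt.continuousWithinAt
  rcases le_total x 0 with hx0 | hx0
  · have hm : MonotoneOn (fun z => Real.log (distribFun I w z) - c * z) (I ∩ Set.Iic 0) := by
      refine monotoneOn_of_deriv_nonneg (h.convex.inter (convex_Iic 0))
        (hcont.mono Set.inter_subset_left) (fun y hy =>
          (hd y (interior_subset hy).1).differentiableAt.differentiableWithinAt) fun y hy => ?_
      obtain ⟨hyI, hy0⟩ := interior_subset hy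
      rw [(hd y hyI).deriv, sub_nonneg, hc,
        div_le_div_iff₀ (h.distribFun_pos h0) (h.distribFun_pos hyI)]
      linarith [h.distribFun_mul_le hyI h0 hy0]
    have := hm ⟨hx, hx0⟩ ⟨h0, Set.self_mem_Iic⟩ hx0
    simp only at this
    linarith
  · have hm : AntitoneOn (fun z => Real.log (distribFun I w z) - c * z) (I ∩ Set.Ici 0) := by
      refine antitoneOn_of_deriv_nonpos (h.convex.inter (convex_Ici 0))
        (hcont.mono Set.inter_subset_left) (fun y hy =>
          (hd y (interior_subset hy).1).differentiableAt.differentiableWithinAt) fun y hy => ?_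
      obtain ⟨hyI, hy0⟩ := interior_subset hy
      rw [(hd y hyI).deriv, sub_nonpos, hc,
        div_le_div_iff₀ (h.distribFun_pos hyI) (h.distribFun_pos h0)]
      linarith [h.distribFun_mul_le h0 hyI hy0]
    have := hm ⟨h0, Set.self_mem_Ici⟩ ⟨hx, hx0⟩ hx0
    simp only at this
    linarith

theorem exists_integrableOn_le_mul (h : IsLogConcaveDensity I w) (h0 : (0 : ℝ) ∈ I) :
    ∃ g : ℝ → ℝ, IntegrableOn g I ∧ ∀ x ∈ I, g x ≤ x * w x := by
  have hc : 0 < w 0 / distribFun I w 0 := div_pos (h.pos 0 h0) (h.distribFun_pos h0)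
  refine ⟨fun x => (Real.log (distribFun I w x) * w x - Real.log (distribFun I w 0) * w x) /
    (w 0 / distribFun I w 0),
    (h.integrableOn_log_distribFun_mul.sub (h.integrableOn.const_mul _)).div_const _,
    fun x hx => ?_⟩
  rw [div_le_iff₀ hc]
  nlinarith [mul_le_mul_of_nonneg_right (h.log_distribFun_le h0 hx) (h.pos x hx).le]

/-- A log-concave density has a first moment. -/
theorem integrableOn_mul (h : IsLogConcaveDensity I w) (h0 : (0 : ℝ) ∈ I) :
    IntegrableOn (fun x => x * w x) I := by
  obtain ⟨g, hg, hgw⟩ := h.exists_integrableOn_le_mul h0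
  obtain ⟨k, hk, hkw⟩ := h.comp_neg.exists_integrableOn_le_mul (by simpa using h0)
  have hk' : IntegrableOn (fun x => k (-x)) I := by simpa using hk.comp_neg
  refine (hg.abs.add hk'.abs).mono'
    ((continuousOn_id.mul h.continuousOn).aestronglyMeasurable h.measurableSet) ?_
  filter_upwards [ae_restrict_mem h.measurableSet] with x hx
  have h1 := hgw x hx
  have h2 := hkw (-x) (by simpa using hx)
  rw [neg_neg] at h2
  simp only [Pi.add_apply, Real.norm_eq_abs]
  refine abs_le.2 ⟨?_, ?_⟩
  · linarith [neg_abs_le (g x), abs_nonneg (k (-x))]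
  · linarith [neg_abs_le (k (-x)), abs_nonneg (g x)]

/-- If the barycenter is `0` and the mass of the negative half-line is `e⁻¹`, then the
distribution function is an exponential. -/
theorem distribFun_eq_exp (h : IsLogConcaveDensity I w) (h0 : (0 : ℝ) ∈ I)
    (hbar : ∫ x in I, x * w x = 0) (heq : distribFun I w 0 = Real.exp (-1)) :
    ∃ c > 0, ∀ x ∈ I, distribFun I w x = Real.exp (c * x - 1) := by
  set c := w 0 / distribFun I w 0 with hc
  refine ⟨c, div_pos (h.pos 0 h0) (h.distribFun_pos h0), ?_⟩
  have hlog : ContinuousOn (fun x => Real.log (distribFun I w x)) I :=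
    h.continuous_distribFun.continuousOn.log fun x hx => (h.distribFun_pos hx).ne'
  have hle : ∀ x ∈ I, Real.log (distribFun I w x) ≤ c * x - 1 := fun x hx => by
    have := h.log_distribFun_le h0 hx
    rw [← hc, heq, Real.log_exp] at this
    linarith
  have hi1 : IntegrableOn (fun x => c * (x * w x) - w x) I :=
    ((h.integrableOn_mul h0).const_mul c).sub h.integrableOn
  have hint : IntegrableOn
      (fun x => (c * (x * w x) - w x) - Real.log (distribFun I w x) * w x) I :=
    hi1.sub h.integrableOn_log_distribFun_mul
  have hzero : ∫ x in I, ((c * (x * w x) - w x) - Real.log (distribFun I w x) * w x) = 0 := by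
    rw [integral_sub hi1 h.integrableOn_log_distribFun_mul,
      integral_sub ((h.integrableOn_mul h0).const_mul c) h.integrableOn,
      integral_const_mul, hbar, h.integral_eq_one, h.integral_log_distribFun_mul]
    norm_num
  have hnn : 0 ≤ᵐ[volume.restrict I]
      fun x => (c * (x * w x) - w x) - Real.log (distribFun I w x) * w x := by
    filter_upwards [ae_restrict_mem h.measurableSet] with x hx
    have := mul_le_mul_of_nonneg_right (hle x hx) (h.pos x hx).le
    simp only [Pi.zero_apply]
    linarith
  have hae := (setIntegral_eq_zero_iff_of_nonneg_ae hnn hint).1 hzero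
  have hEq : Set.EqOn (fun x => Real.log (distribFun I w x)) (fun x => c * x - 1) I := by
    refine Measure.eqOn_open_of_ae_eq (μ := volume) ?_ h.isOpen hlog (by fun_prop)
    filter_upwards [hae, ae_restrict_mem h.measurableSet] with x hx hxI
    simp only [Pi.zero_apply] at hx
    refine mul_right_cancel₀ (h.pos x hxI).ne' ?_
    linarith
  intro x hx
  exact (Real.exp_log (h.distribFun_pos hx)).symm.trans (congrArg Real.exp (hEq hx))

/-- A density whose distribution function is exponential is the truncated exponential one. -/
theorem eq_exp_of_distribFun_eq_exp (h : IsLogConcaveDensity I w) {c : ℝ} (hc : 0 < c)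
    (hF : ∀ x ∈ I, distribFun I w x = Real.exp (c * x - 1)) :
    I = Set.Iio (1 / c) ∧ ∀ x ∈ I, w x = c * Real.exp (c * x - 1) := by
  have hlt : ∀ x : ℝ, Real.exp (c * x - 1) < 1 ↔ x < 1 / c := fun x => by
    rw [Real.exp_lt_one_iff, sub_neg, lt_div_iff₀' hc]
  constructor
  · ext x
    rw [Set.mem_Iio, ← hlt]
    constructor
    · intro hx
      rw [← hF x hx]
      exact h.distribFun_lt_one hx
    · intro hx
      obtain ⟨y, hy, hyx⟩ := h.image_distribFun.ge ⟨Real.exp_pos (c * x - 1), hx⟩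
      rw [hF y hy, Real.exp_eq_exp, sub_left_inj, mul_right_inj' hc.ne'] at hyx
      exact hyx ▸ hy
  · intro x hx
    have hd : HasDerivAt (fun y => Real.exp (c * y - 1)) (c * Real.exp (c * x - 1)) x := by
      simpa [mul_comm] using (((hasDerivAt_id x).const_mul c).sub_const 1).exp
    refine (h.hasDerivAt_distribFun hx).unique (hd.congr_of_eventuallyEq ?_)
    filter_upwards [h.isOpen.mem_nhds hx] with y hy using hF y hy

end IsLogConcaveDensity

theorem isOpen_erealIoo (a b : EReal) : IsOpen (erealIoo a b) :=
  isOpen_Ioo.preimage continuous_coe_real_ereal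

theorem eq_bot_and_eq_coe_of_erealIoo_eq_Iio {a b : EReal} {r : ℝ} (ha : a < 0) (hb : 0 < b)
    (hr : 0 < r) (h : erealIoo a b = Set.Iio r) : a = ⊥ ∧ b = (r : EReal) := by
  have hmem : ∀ x : ℝ, (a < (x : EReal) ∧ (x : EReal) < b) ↔ x < r := fun x => by
    change x ∈ erealIoo a b ↔ x ∈ Set.Iio r
    rw [h]
  constructor
  · induction a with
    | bot => rfl
    | top => exact absurd ha (by simp)
    | coe a =>
      exact absurd ((hmem a).2 ((EReal.coe_lt_coe_iff.1 ha).trans hr)).1 (lt_irrefl _)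
  · have har : a < (r : EReal) := ha.trans (EReal.coe_lt_coe_iff.2 hr)
    refine le_antisymm (not_lt.1 fun hrb => lt_irrefl r ((hmem r).1 ⟨har, hrb⟩)) ?_
    induction b with
    | bot => exact absurd hb (by simp)
    | top => exact le_top
    | coe b =>
      rw [EReal.coe_le_coe_iff]
      exact not_lt.1 fun hbr => lt_irrefl _ ((hmem b).2 hbr).2

/-- Rigidity in the one-dimensional Grünbaum inequality for log-concave densities:
equality `∫_a^0 w = e⁻¹` forces `a = -∞`, `b = 1/c` and the truncated exponential
model density. -/
theorem grunbaum_one_dim_logconcave_rigidity (a b : EReal) (w : ℝ → ℝ)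
    (ha : a < (0 : EReal)) (hb : (0 : EReal) < b)
    (hw : ∀ x ∈ erealIoo a b, 0 < w x)
    (hint : IntegrableOn w (erealIoo a b))
    (hconc : ConcaveOn ℝ (erealIoo a b) (fun x => Real.log (w x)))
    (hmass : ∫ x in erealIoo a b, w x = 1)
    (hbar : ∫ x in erealIoo a b, x * w x = 0)
    (heq : ∫ x in erealIoo a b ∩ Set.Iio (0 : ℝ), w x = Real.exp (-1)) :
    ∃ c > 0, a = ⊥ ∧ b = ((1 / c : ℝ) : EReal) ∧
      ∀ x ∈ erealIoo a b, w x = c * Real.exp (c * x - 1) := by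
  have h : IsLogConcaveDensity (erealIoo a b) w :=
    ⟨isOpen_erealIoo a b, hconc.1, hw, hint, hconc, hmass⟩
  have h0 : (0 : ℝ) ∈ erealIoo a b := ⟨ha, hb⟩
  have hF0 : distribFun (erealIoo a b) w 0 = Real.exp (-1) := by
    rw [← heq, distribFun, integral_Iic_eq_integral_Iio, setIntegral_indicator h.measurableSet,
      Set.inter_comm]
  obtain ⟨c, hc, hF⟩ := h.distribFun_eq_exp h0 hbar hF0
  obtain ⟨hI, hwc⟩ := h.eq_exp_of_distribFun_eq_exp hc hF
  obtain ⟨ha', hb'⟩ := eq_bot_and_eq_coe_of_erealIoo_eq_Iio ha hb (one_div_pos.2 hc) hI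
  exact ⟨c, hc, ha', hb', hwc⟩
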